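/- arXiv:1702.00285 — 3 statements merged into one kernel-verified Lean document; each statement's English description precedes it below -/
import Mathlib

section
/- For every prime power q with q ≡ 1 (mod 4), the Paley graph P(q) is a strongly regular graph with parameters v = q, k = (q−1)/2, λ = (q−5)/4 and μ = (q−1)/4; that is, P(q) has q vertices, every vertex has degree (q−1)/2, every pair of adjacent vertices has exactly (q−5)/4 common neighbours, and every pair of distinct non-adjacent vertices has exactly (q−1)/4 common neighbours. -/
/-- The Paley graph on a finite field `F`: distinct vertices `u`, `v` are adjacent iff
`u - v` is a (nonzero) square. -/
def paleyGraph (F : Type*) [Field F] : SimpleGraph F :=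
  SimpleGraph.fromRel fun u v => IsSquare (u - v)

open scoped Classical in
lemma quadraticChar_sum_sub_left {F : Type*} [Field F] [Fintype F] (hF : ringChar F ≠ 2) (v : F) :
    ∑ x : F, quadraticChar F (v - x) = 0 :=
  ((Equiv.subLeft v).sum_comp (quadraticChar F)).trans (quadraticChar_sum_zero hF)

open scoped Classical in
lemma quadraticChar_sum_mul_shift {F : Type*} [Field F] [Fintype F] (hF : ringChar F ≠ 2)
    {v w : F} (hvw : v ≠ w) :
    ∑ x : F, quadraticChar F (v - x) * quadraticChar F (w - x) = -1 := by
  have hd : v - w ≠ 0 := sub_ne_zero.mpr hvw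
  have hJ := jacobiSum_nontrivial_inv (quadraticChar_ne_one hF)
  rw [(quadraticChar_isQuadratic F).inv, jacobiSum] at hJ
  rw [← ((Equiv.mulLeft₀ (v - w) hd).trans (Equiv.subLeft v)).sum_comp]
  have hterm (t : F) :
      quadraticChar F (v - ((Equiv.mulLeft₀ (v - w) hd).trans (Equiv.subLeft v)) t) *
        quadraticChar F (w - ((Equiv.mulLeft₀ (v - w) hd).trans (Equiv.subLeft v)) t) =
      quadraticChar F (-1) * (quadraticChar F t * quadraticChar F (1 - t)) := by
    have h1 : v - ((Equiv.mulLeft₀ (v - w) hd).trans (Equiv.subLeft v)) t = (v - w) * t := by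
      simp
    have h2 : w - ((Equiv.mulLeft₀ (v - w) hd).trans (Equiv.subLeft v)) t =
        -1 * ((v - w) * (1 - t)) := by
      linear_combination h1
    rw [h1, h2]
    simp only [map_mul]
    linear_combination quadraticChar F (-1) * quadraticChar F t * quadraticChar F (1 - t) *
      quadraticChar_sq_one hd
  rw [Finset.sum_congr rfl fun t _ ↦ hterm t, ← Finset.mul_sum, hJ]
  linear_combination -quadraticChar_sq_one (F := F) (neg_ne_zero.mpr one_ne_zero)

open scoped Classical in
lemma two_mul_ite_quadraticChar_eq_one {F : Type*} [Field F] [Fintype F] (v x : F) :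
    2 * (if quadraticChar F (v - x) = 1 then 1 else 0 : ℤ) =
      1 - (if v = x then 1 else 0) + quadraticChar F (v - x) := by
  by_cases hvx : v = x
  · simp [hvx]
  · rcases quadraticChar_dichotomy (sub_ne_zero.mpr hvx) with h | h <;> simp [h, hvx]

open scoped Classical in
lemma two_mul_card_quadraticChar_sub_eq_one {F : Type*} [Field F] [Fintype F]
    (hF : ringChar F ≠ 2) (v : F) :
    2 * ((Finset.univ.filter fun x : F ↦ quadraticChar F (v - x) = 1).card : ℤ) =
      Fintype.card F - 1 := by
  rw [Finset.card_filter, Nat.cast_sum, Finset.mul_sum]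
  push_cast
  simp_rw [two_mul_ite_quadraticChar_eq_one]
  rw [Finset.sum_add_distrib, quadraticChar_sum_sub_left hF]
  simp

open scoped Classical in
lemma four_mul_card_quadraticChar_sub_eq_one {F : Type*} [Field F] [Fintype F]
    (hF : ringChar F ≠ 2) {v w : F} (hvw : v ≠ w) :
    4 * ((Finset.univ.filter fun x : F ↦
        quadraticChar F (v - x) = 1 ∧ quadraticChar F (w - x) = 1).card : ℤ) =
      Fintype.card F - 3 - quadraticChar F (v - w) - quadraticChar F (w - v) := by
  have hterm (x : F) :
      4 * (if quadraticChar F (v - x) = 1 ∧ quadraticChar F (w - x) = 1 then 1 else 0 : ℤ) =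
      1 - (if v = x then 1 else 0) - (if w = x then 1 else 0)
        - (if v = x then quadraticChar F (w - x) else 0)
        - (if w = x then quadraticChar F (v - x) else 0)
        + quadraticChar F (v - x) + quadraticChar F (w - x)
        + quadraticChar F (v - x) * quadraticChar F (w - x) := by
    have hprod : 4 * (if quadraticChar F (v - x) = 1 ∧ quadraticChar F (w - x) = 1
        then 1 else 0 : ℤ) = (2 * if quadraticChar F (v - x) = 1 then 1 else 0) *
          (2 * if quadraticChar F (w - x) = 1 then 1 else 0) := by
      rw [ite_and]
      split_ifs <;> rfl
    rw [hprod, two_mul_ite_quadraticChar_eq_one, two_mul_ite_quadraticChar_eq_one]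
    have hnot : ¬(v = x ∧ w = x) := fun h ↦ hvw (h.1.trans h.2.symm)
    split_ifs <;> first | exact absurd ⟨‹v = x›, ‹w = x›⟩ hnot | ring
  rw [Finset.card_filter, Nat.cast_sum, Finset.mul_sum]
  push_cast
  simp_rw [hterm]
  simp only [Finset.sum_add_distrib, Finset.sum_sub_distrib, quadraticChar_sum_sub_left hF,
    quadraticChar_sum_mul_shift hF hvw, Finset.sum_ite_eq, Finset.mem_univ, if_true,
    Finset.sum_const, Finset.card_univ, nsmul_eq_mul, mul_one]
  ring

open scoped Classical in
lemma quadraticChar_sub_comm {F : Type*} [Field F] [Fintype F]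
    (h : IsSquare (-1 : F)) (v w : F) : quadraticChar F (v - w) = quadraticChar F (w - v) := by
  rw [← neg_sub, neg_eq_neg_one_mul, map_mul,
    (quadraticChar_one_iff_isSquare (neg_ne_zero.mpr one_ne_zero)).mpr h, one_mul]

open scoped Classical in
lemma paleyGraph_adj_iff_quadraticChar {F : Type*} [Field F] [Fintype F]
    (h : IsSquare (-1 : F)) {v w : F} :
    (paleyGraph F).Adj v w ↔ quadraticChar F (v - w) = 1 := by
  rw [paleyGraph, SimpleGraph.fromRel_adj]
  by_cases hvw : v = w
  · simp [hvw]
  · rw [← quadraticChar_one_iff_isSquare (sub_ne_zero.mpr hvw),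
      ← quadraticChar_one_iff_isSquare (sub_ne_zero.mpr (Ne.symm hvw)),
      quadraticChar_sub_comm h w v, or_self]
    exact and_iff_right hvw

open scoped Classical in
lemma four_mul_card_commonNeighbors_paleyGraph {F : Type*} [Field F] [Fintype F]
    (hF : ringChar F ≠ 2) (h : IsSquare (-1 : F)) {v w : F} (hvw : v ≠ w) :
    4 * (Fintype.card ((paleyGraph F).commonNeighbors v w) : ℤ) =
      Fintype.card F - 3 - 2 * quadraticChar F (v - w) := by
  have hcard := four_mul_card_quadraticChar_sub_eq_one hF hvw
  simp_rw [← paleyGraph_adj_iff_quadraticChar h] at hcard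
  rw [quadraticChar_sub_comm h w v] at hcard
  rw [Fintype.card_of_subtype (Finset.univ.filter fun x : F ↦
    (paleyGraph F).Adj v x ∧ (paleyGraph F).Adj w x)
    fun x ↦ by simp [SimpleGraph.mem_commonNeighbors]]
  linarith

open scoped Classical in
/-- For every prime power `q ≡ 1 (mod 4)`, the Paley graph `P(q)` is strongly regular with
parameters `v = q`, `k = (q−1)/2`, `λ = (q−5)/4`, `μ = (q−1)/4`. -/
theorem paleyGraph_isSRG {F : Type*} [Field F] [Fintype F]
    (h4 : Fintype.card F % 4 = 1) :
    (paleyGraph F).IsSRGWith (Fintype.card F) ((Fintype.card F - 1) / 2)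
      ((Fintype.card F - 5) / 4) ((Fintype.card F - 1) / 4) := by
  have hF : ringChar F ≠ 2 := fun h2 ↦ by
    have := FiniteField.even_card_iff_char_two.mp h2
    omega
  have hneg : IsSquare (-1 : F) := FiniteField.isSquare_neg_one_iff.mpr (by omega)
  have hq : 1 < Fintype.card F := Fintype.one_lt_card
  refine ⟨rfl, fun v ↦ ?_, fun v w hvw ↦ ?_, fun v w hne hvw ↦ ?_⟩
  · have hcard := two_mul_card_quadraticChar_sub_eq_one hF v
    simp_rw [← paleyGraph_adj_iff_quadraticChar hneg] at hcard
    rw [← SimpleGraph.card_neighborFinset_eq_degree, SimpleGraph.neighborFinset_eq_filter]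
    omega
  · have hcard := four_mul_card_commonNeighbors_paleyGraph hF hneg hvw.ne
    rw [(paleyGraph_adj_iff_quadraticChar hneg).mp hvw] at hcard
    omega
  · have hcard := four_mul_card_commonNeighbors_paleyGraph hF hneg hne
    rw [paleyGraph_adj_iff_quadraticChar hneg,
      ← quadraticChar_eq_neg_one_iff_not_one (sub_ne_zero.mpr hne)] at hvw
    rw [hvw] at hcard
    omega
end

section
/- Let q = p^e be a prime power with q ≡ 1 (mod 4). A permutation σ of F_q is an automorphism of the Paley graph P(q) if and only if there exist a nonzero square a ∈ F_q, an element b ∈ F_q, and a natural number i such that σ(v) = a·v^{p^i} + b for all v ∈ F_q. (Equivalently, Aut P(q) = AΔL₁(q).) -/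
open Polynomial

/-- A special case of Lucas' theorem: if every base-`p` digit of `k` is at most `h < p`, then
`p` does not divide `choose n k`, where all digits of `n` equal `h`. -/
lemma not_dvd_choose_of_digits_le {p h : ℕ} (hp : p.Prime) (hh : h < p) (e : ℕ) (d : ℕ → ℕ)
    (hd : ∀ i, d i ≤ h) :
    ¬ p ∣ (∑ i ∈ Finset.range e, h * p ^ i).choose (∑ i ∈ Finset.range e, d i * p ^ i) := by
  induction e generalizing d with
  | zero => simpa using hp.one_lt.ne'
  | succ e ih =>
    have : Fact p.Prime := ⟨hp⟩
    have hsplit : ∀ c : ℕ → ℕ, ∑ i ∈ Finset.range (e + 1), c i * p ^ i =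
        c 0 + p * ∑ i ∈ Finset.range e, c (i + 1) * p ^ i := by
      intro c
      rw [Finset.sum_range_succ', Finset.mul_sum, add_comm]
      simp only [pow_zero, mul_one, pow_succ]
      congr 1
      exact Finset.sum_congr rfl fun i _ => by ring
    have h0 := hd 0
    rw [hsplit d, hsplit fun _ => h,
      (Choose.choose_modEq_choose_mod_mul_choose_div_nat (p := p)).dvd_iff dvd_rfl,
      Nat.add_mul_mod_self_left, Nat.add_mul_mod_self_left, Nat.add_mul_div_left _ _ hp.pos,
      Nat.add_mul_div_left _ _ hp.pos, Nat.mod_eq_of_lt hh, Nat.mod_eq_of_lt (h0.trans_lt hh),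
      Nat.div_eq_of_lt hh, Nat.div_eq_of_lt (h0.trans_lt hh), zero_add, zero_add, hp.dvd_mul,
      not_or]
    refine ⟨fun hdvd => ?_, ih _ fun i => hd _⟩
    have := Nat.choose_mul_factorial_mul_factorial h0 ▸ (hdvd.mul_right _).mul_right _
    exact absurd ((hp.dvd_factorial).1 this) (by omega)

/-- If `D i` bounds the residue of `j * p ^ i` modulo `p ^ e - 1` for `i < e`, and the sum of the
`D i` is at most `1 + p + ⋯ + p ^ (e - 1)`, then `j` is a power of `p` and `j = D 0`. -/
lemma eq_and_eq_pow_of_sum_mod_le {p e j : ℕ} (hp : 2 ≤ p) (hj0 : 0 < j) (hj : j < p ^ e - 1)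
    (D : ℕ → ℕ) (hD : ∀ i < e, j * p ^ i % (p ^ e - 1) ≤ D i)
    (hsum : ∑ i ∈ Finset.range e, D i ≤ ∑ i ∈ Finset.range e, p ^ i) :
    j = D 0 ∧ ∃ k, j = p ^ k := by
  obtain ⟨N, hN⟩ : ∃ N, p ^ e = N + 1 := ⟨p ^ e - 1, by omega⟩
  rw [hN, Nat.add_sub_cancel] at hD hj
  have he : 0 < e := by
    rcases Nat.eq_zero_or_pos e with rfl | he
    · simp at hN; omega
    · exact he
  set s : ℕ → ℕ := fun i => j * p ^ i % N with hs
  set t : ℕ → ℕ := fun i => p * s i / N with ht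
  have hst : ∀ i, p * s i = s (i + 1) + N * t i := by
    intro i
    have : s (i + 1) = p * s i % N := by
      simp only [hs, Nat.mul_mod_mod]
      rw [pow_succ]
      ring_nf
    rw [this, Nat.mod_add_div]
  have hs0 : s 0 = j := by simp [hs, Nat.mod_eq_of_lt hj]
  have hse : s e = j := by
    simp only [hs, hN, mul_add, mul_one]
    rw [Nat.mul_add_mod_self_right, Nat.mod_eq_of_lt hj]
  have hR : (p - 1) * ∑ i ∈ Finset.range e, p ^ i = N := by
    obtain ⟨p', rfl⟩ : ∃ p', p = p' + 1 := ⟨p - 1, by omega⟩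
    have := geom_sum_mul_add p' e
    rw [Nat.add_sub_cancel, mul_comm]
    omega
  have hshift : ∑ i ∈ Finset.range e, s (i + 1) = ∑ i ∈ Finset.range e, s i := by
    have h1 := Finset.sum_range_succ s e
    rw [Finset.sum_range_succ'] at h1
    omega
  have hST : ∑ i ∈ Finset.range e, s i =
      (∑ i ∈ Finset.range e, p ^ i) * ∑ i ∈ Finset.range e, t i := by
    have h1 : p * ∑ i ∈ Finset.range e, s i =
        ∑ i ∈ Finset.range e, s i + N * ∑ i ∈ Finset.range e, t i := by
      rw [Finset.mul_sum, Finset.mul_sum, ← hshift, ← Finset.sum_add_distrib]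
      exact Finset.sum_congr rfl fun i _ => hst i
    obtain ⟨p', rfl⟩ : ∃ p', p = p' + 1 := ⟨p - 1, by omega⟩
    rw [Nat.add_sub_cancel] at hR
    refine Nat.eq_of_mul_eq_mul_left (show 0 < p' by omega) ?_
    rw [← mul_assoc, hR]
    linarith
  have hspos : 0 < ∑ i ∈ Finset.range e, s i :=
    Finset.sum_pos' (fun _ _ => Nat.zero_le _) ⟨0, Finset.mem_range.2 he, hs0 ▸ hj0⟩
  have hsD : ∑ i ∈ Finset.range e, s i ≤ ∑ i ∈ Finset.range e, D i :=
    Finset.sum_le_sum fun i hi => hD i (Finset.mem_range.1 hi)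
  have hT : ∑ i ∈ Finset.range e, t i = 1 := by
    rw [hST] at hspos hsD
    have h1 := Nat.pos_of_mul_pos_left hspos
    have h2 := Nat.pos_of_mul_pos_right hspos
    have h3 := Nat.le_of_mul_le_mul_left ((hsD.trans hsum).trans_eq (mul_one _).symm) (by assumption)
    omega
  constructor
  · rw [hT, mul_one] at hST
    rw [← hs0]
    exact (Finset.sum_eq_sum_iff_of_le fun i hi => hD i (Finset.mem_range.1 hi)).1
      (le_antisymm hsD (hsum.trans_eq hST.symm)) 0 (Finset.mem_range.2 he)
  · have htel : ∀ n, p ^ n * j = s n + N * ∑ i ∈ Finset.range n, t i * p ^ (n - 1 - i) := by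
      intro n
      induction n with
      | zero => simp [hs0]
      | succ n ih =>
        have : ∑ i ∈ Finset.range n, t i * p ^ (n + 1 - 1 - i) =
            p * ∑ i ∈ Finset.range n, t i * p ^ (n - 1 - i) := by
          rw [Finset.mul_sum]
          refine Finset.sum_congr rfl fun i hi => ?_
          rw [Finset.mem_range] at hi
          rw [show n + 1 - 1 - i = (n - 1 - i) + 1 by omega, pow_succ]
          ring
        rw [Finset.sum_range_succ, this, Nat.add_sub_cancel, Nat.sub_self, pow_zero, mul_one,
          pow_succ', mul_assoc, ih, mul_add, hst]
        ring
    have hje : j = ∑ i ∈ Finset.range e, t i * p ^ (e - 1 - i) := by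
      refine Nat.eq_of_mul_eq_mul_left (show 0 < N by omega) ?_
      have := htel e
      rw [hN, hse] at this
      linarith
    obtain ⟨k, hk, htk⟩ := Finset.exists_ne_zero_of_sum_ne_zero (hT.trans_ne one_ne_zero)
    rw [← Finset.add_sum_erase _ _ hk] at hT
    have hz : ∑ i ∈ (Finset.range e).erase k, t i = 0 := by omega
    rw [Finset.sum_eq_zero_iff] at hz
    refine ⟨e - 1 - k, ?_⟩
    rw [hje, Finset.sum_eq_single_of_mem k hk fun i hi hik => by
      rw [hz i (Finset.mem_erase.2 ⟨hik, hi⟩), zero_mul], show t k = 1 by omega, one_mul]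

section FiniteField

variable {F : Type*} [Field F] [Fintype F]

lemma sum_pow_card_sub_one_add_sub {i j : ℕ} (hi : i < Fintype.card F - 1)
    (hj : j < Fintype.card F - 1) :
    ∑ x : F, x ^ (Fintype.card F - 1 + j - i) = if i = j then -1 else 0 := by
  classical
  rcases lt_trichotomy i j with hij | rfl | hij
  · rw [if_neg hij.ne, ← FiniteField.sum_pow_lt_card_sub_one F (j - i) (by omega)]
    refine Finset.sum_congr rfl fun x _ => ?_
    obtain ⟨k, hk⟩ : ∃ k, j - i = k + 1 := ⟨j - i - 1, by omega⟩
    rw [show Fintype.card F - 1 + j - i = Fintype.card F + k by omega, pow_add,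
      FiniteField.pow_card, hk, pow_succ']
  · rw [if_pos rfl, Nat.add_sub_cancel]
    have : ∀ x : F, x ^ (Fintype.card F - 1) = 1 - if x = 0 then 1 else 0 := by
      intro x
      split_ifs with hx
      · rw [hx, zero_pow (by omega), sub_self]
      · rw [FiniteField.pow_card_sub_one_eq_one x hx, sub_zero]
    simp [this]
  · rw [if_neg hij.ne', FiniteField.sum_pow_lt_card_sub_one F _ (by omega)]

/-- If `σ` preserves `m`-th powers of differences, then `σ ^ j` is a polynomial function of degree
at most `m` whenever `choose m j` is invertible in `F`. -/
lemma exists_natDegree_le_eval_eq_pow {m : ℕ} (hm : m < Fintype.card F - 1) (σ : Equiv.Perm F)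
    (hσ : ∀ u v, (σ u - σ v) ^ m = (u - v) ^ m) {j : ℕ} (hj : j ≤ m)
    (hc : (m.choose j : F) ≠ 0) :
    ∃ P : F[X], P.natDegree ≤ m ∧ ∀ x, P.eval x = σ x ^ j := by
  set c : F := -((-1) ^ (m - j) * m.choose j) with hcdef
  have hc0 : c ≠ 0 := by simp [hcdef, hc]
  refine ⟨∑ z : F, C (c⁻¹ * z ^ (Fintype.card F - 1 - (m - j))) * (X - C (σ.symm z)) ^ m,
    natDegree_sum_le_of_forall_le _ _ fun z _ => ?_, fun x => ?_⟩
  · refine (natDegree_C_mul_le _ _).trans ?_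
    rw [natDegree_pow, natDegree_X_sub_C, mul_one]
  · have key : ∀ z : F, z ^ (Fintype.card F - 1 - (m - j)) * (x - σ.symm z) ^ m =
        ∑ i ∈ Finset.range (m + 1), σ x ^ i * ((-1) ^ (m - i) * m.choose i) *
          z ^ (Fintype.card F - 1 + j - i) := by
      intro z
      rw [← hσ, Equiv.apply_symm_apply, sub_eq_add_neg, add_pow, Finset.mul_sum]
      refine Finset.sum_congr rfl fun i hi => ?_
      rw [Finset.mem_range] at hi
      rw [neg_pow z, show Fintype.card F - 1 + j - i = (Fintype.card F - 1 - (m - j)) + (m - i) by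
        omega, pow_add]
      ring
    rw [eval_finsetSum]
    simp only [eval_mul, eval_C, eval_pow, eval_sub, eval_X, mul_assoc c⁻¹]
    rw [← Finset.mul_sum, Finset.sum_congr rfl fun z _ => key z, Finset.sum_comm]
    simp only [← Finset.mul_sum]
    rw [Finset.sum_eq_single_of_mem j (Finset.mem_range.2 (by omega))]
    · rw [sum_pow_card_sub_one_add_sub (by omega) (by omega), if_pos rfl, inv_mul_eq_iff_eq_mul₀ hc0,
        hcdef]
      ring
    · intro i hi hij
      rw [Finset.mem_range] at hi
      rw [sum_pow_card_sub_one_add_sub (by omega) (by omega), if_neg hij, mul_zero]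

lemma eq_of_natDegree_lt_card_of_forall_eval_eq {P Q : F[X]} (hP : P.natDegree < Fintype.card F)
    (hQ : Q.natDegree < Fintype.card F) (h : ∀ x, P.eval x = Q.eval x) : P = Q :=
  eq_of_natDegree_lt_card_of_eval_eq P Q Function.injective_id h (max_lt hP hQ)

/-- If `Q` has degree less than `q` and represents the function `P ^ p ^ i`, then its exponents
include the residues modulo `q - 1` of `j * p ^ i` for the exponents `j` of `P`. -/
lemma mod_le_natDegree_of_eval_eq_pow {p : ℕ} [Fact p.Prime] [CharP F p]
    (hcop : (Fintype.card F - 1).Coprime p) {P Q : F[X]} {i j : ℕ}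
    (hP : P.natDegree < Fintype.card F - 1) (hQ : Q.natDegree < Fintype.card F)
    (h : ∀ x, Q.eval x = P.eval x ^ p ^ i) (hj : P.coeff j ≠ 0) :
    j * p ^ i % (Fintype.card F - 1) ≤ Q.natDegree := by
  set N := Fintype.card F - 1 with hN
  have hlt : ∀ k ∈ P.support, k < N := fun k hk => (le_natDegree_of_mem_supp k hk).trans_lt hP
  have hinj : ∀ k ∈ P.support, ∀ l ∈ P.support, k * p ^ i % N = l * p ^ i % N → k = l :=
    fun k hk l hl hkl => Nat.ModEq.eq_of_lt_of_lt
      (Nat.ModEq.cancel_right_of_coprime (hcop.pow_right i) hkl) (hlt k hk) (hlt l hl)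
  have hQG : Q = ∑ k ∈ P.support, C (P.coeff k ^ p ^ i) * X ^ (k * p ^ i % N) := by
    refine eq_of_natDegree_lt_card_of_forall_eval_eq hQ ?_ fun x => ?_
    · refine (natDegree_sum_le_of_forall_le (n := N - 1) _ _ fun k _ =>
        (natDegree_C_mul_X_pow_le _ _).trans ?_).trans_lt (by omega)
      have := Nat.mod_lt (k * p ^ i) (show 0 < N by omega)
      omega
    · rw [h, eval_eq_sum, Polynomial.sum, sum_pow_char_pow, eval_finsetSum]
      refine Finset.sum_congr rfl fun k hk => ?_
      rw [mul_pow, ← pow_mul, eval_mul, eval_C, eval_pow, eval_X]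
      congr 1
      rcases eq_or_ne x 0 with rfl | hx
      · rcases Nat.eq_zero_or_pos k with rfl | hk0
        · simp
        · have hpi : 0 < p ^ i := pow_pos (Fact.out : p.Prime).pos i
          rw [zero_pow (by positivity), zero_pow]
          intro hmod
          have := Nat.le_of_dvd hk0
            ((hcop.pow_right i).dvd_of_dvd_mul_right (Nat.dvd_of_mod_eq_zero hmod))
          have := hlt k hk
          omega
      · exact pow_eq_pow_mod _ (FiniteField.pow_card_sub_one_eq_one x hx)
  have hjs : j ∈ P.support := mem_support_iff.2 hj
  refine le_natDegree_of_ne_zero ?_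
  rw [hQG, finsetSum_coeff, Finset.sum_eq_single_of_mem j hjs, coeff_C_mul_X_pow, if_pos rfl]
  · exact pow_ne_zero _ hj
  · intro k hk hkj
    rw [coeff_C_mul_X_pow, if_neg fun hjk => hkj (hinj k hk j hjs hjk.symm)]

/-- If all the products `∏ f i ^ d i` are, as functions, polynomials of degree at most `m`, where
`2 * m < q`, then they have degree at most `m` themselves. -/
lemma natDegree_prod_pow_le {e h m : ℕ} (hm : 2 * m < Fintype.card F) (f : ℕ → F[X])
    (hf : ∀ i < e, (f i).natDegree ≤ m)
    (hex : ∀ d : ℕ → ℕ, (∀ i, d i ≤ h) → ∃ P : F[X], P.natDegree ≤ m ∧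
      ∀ x, P.eval x = (∏ i ∈ Finset.range e, f i ^ d i).eval x)
    (d : ℕ → ℕ) (hd : ∀ i, d i ≤ h) :
    (∏ i ∈ Finset.range e, f i ^ d i).natDegree ≤ m := by
  induction hs : ∑ i ∈ Finset.range e, d i generalizing d with
  | zero =>
    rw [Finset.sum_eq_zero_iff] at hs
    rw [Finset.prod_eq_one fun i hi => by rw [hs i hi, pow_zero]]
    simp
  | succ s ih =>
    obtain ⟨k, hk, hdk⟩ := Finset.exists_ne_zero_of_sum_ne_zero (hs.trans_ne s.succ_ne_zero)
    set d' := Function.update d k (d k - 1) with hd'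
    have hd'k : d' k = d k - 1 := by simp [hd']
    have hd'i : ∀ i ∈ (Finset.range e).erase k, d' i = d i := fun i hi => by
      simp [hd', Finset.ne_of_mem_erase hi]
    have hle := ih d' (fun i => by
      rcases eq_or_ne i k with rfl | hik
      · exact hd'k.trans_le ((Nat.sub_le _ _).trans (hd i))
      · simpa [hd', hik] using hd i) (by
      have hsum := Finset.add_sum_erase _ d hk
      rw [← Finset.add_sum_erase _ d' hk, Finset.sum_congr rfl hd'i, hd'k]
      change _ + ∑ i ∈ (Finset.range e).erase k, d i = s
      omega)
    have hprod : ∏ i ∈ Finset.range e, f i ^ d i =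
        f k * ∏ i ∈ Finset.range e, f i ^ d' i := by
      rw [← Finset.mul_prod_erase _ _ hk, ← Finset.mul_prod_erase _ (fun i => f i ^ d' i) hk,
        ← mul_assoc, hd'k, mul_pow_sub_one hdk]
      congr 1
      exact Finset.prod_congr rfl fun i hi => by rw [hd'i i hi]
    obtain ⟨P, hP, hPe⟩ := hex d hd
    rw [← eq_of_natDegree_lt_card_of_forall_eval_eq (by omega) ?_ hPe]
    · exact hP
    · rw [hprod]
      have := hf k (Finset.mem_range.1 hk)
      exact natDegree_mul_le.trans_lt (by omega)

/-- **Carlitz's theorem**: a permutation of a finite field of odd order that preserves the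
quadratic character of differences is, up to an affine map, a field automorphism. -/
theorem exists_eq_mul_pow_add {p : ℕ} (hp : p.Prime) [CharP F p] (hp2 : p ≠ 2) (σ : Equiv.Perm F)
    (hσ : ∀ u v, (σ u - σ v) ^ (Fintype.card F / 2) = (u - v) ^ (Fintype.card F / 2)) :
    ∃ (a b : F) (i : ℕ), ∀ v : F, σ v = a * v ^ p ^ i + b := by
  have : Fact p.Prime := ⟨hp⟩
  obtain ⟨e, -, hq⟩ := FiniteField.card F p
  generalize (e : ℕ) = e at hq
  have hq1 : 1 < Fintype.card F := Fintype.one_lt_card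
  obtain ⟨h, hh⟩ := hp.odd_of_ne_two hp2
  have hh0 : 0 < h := by have := hp.two_le; omega
  set m := Fintype.card F / 2 with hm
  have hgeom : 2 * (h * ∑ i ∈ Finset.range e, p ^ i) + 1 = Fintype.card F := by
    rw [hq, hh, ← geom_sum_mul_add]
    ring
  have hmr : m = h * ∑ i ∈ Finset.range e, p ^ i := by omega
  have hmq : 2 * m + 1 = Fintype.card F := by omega
  have hm' : m = ∑ i ∈ Finset.range e, h * p ^ i := by rw [hmr, Finset.mul_sum]
  have he : 0 < e := by
    rcases Nat.eq_zero_or_pos e with rfl | he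
    · simp at hq; omega
    · exact he
  have hpow : ∀ d : ℕ → ℕ, (∀ i, d i ≤ h) → ∃ P : F[X], P.natDegree ≤ m ∧
      ∀ x, P.eval x = σ x ^ ∑ i ∈ Finset.range e, d i * p ^ i := by
    intro d hd
    refine exists_natDegree_le_eval_eq_pow (by omega) σ hσ ?_ ?_
    · rw [hm']
      exact Finset.sum_le_sum fun i _ => Nat.mul_le_mul_right _ (hd i)
    · rw [hm', Ne, CharP.cast_eq_zero_iff F p]
      exact not_dvd_choose_of_digits_le hp (by omega) e d hd
  have hfrob : ∀ i, ∃ P : F[X], i < e → P.natDegree ≤ m ∧ ∀ x, P.eval x = σ x ^ p ^ i := by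
    intro i
    by_cases hi : i < e
    · obtain ⟨P, hP, hPe⟩ := hpow (Pi.single i 1) fun k => by
        rcases eq_or_ne k i with rfl | hk
        · simpa using Nat.succ_le_of_lt hh0
        · simp [hk]
      refine ⟨P, fun _ => ⟨hP, fun x => ?_⟩⟩
      rw [hPe, Finset.sum_eq_single_of_mem i (Finset.mem_range.2 hi) fun k _ hk => by simp [hk]]
      simp
    · exact ⟨0, fun h => absurd h hi⟩
  choose f hf using hfrob
  have hf0 : ∀ x, (f 0).eval x = σ x := fun x => by simpa using (hf 0 he).2 x
  have hne : ∀ i ∈ Finset.range e, f i ^ h ≠ 0 := by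
    intro i hi
    refine pow_ne_zero _ fun h0 => ?_
    have := (hf i (Finset.mem_range.1 hi)).2 (σ.symm 1)
    simp [h0] at this
  have hdeg : ∑ i ∈ Finset.range e, (f i).natDegree ≤ ∑ i ∈ Finset.range e, p ^ i := by
    have := natDegree_prod_pow_le (h := h) (m := m) (by omega) f (fun i hi => (hf i hi).1)
      (fun d hd => by
        obtain ⟨P, hP, hPe⟩ := hpow d hd
        refine ⟨P, hP, fun x => ?_⟩
        rw [hPe, eval_prod, ← Finset.prod_pow_eq_pow_sum]
        refine Finset.prod_congr rfl fun i hi => ?_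
        rw [eval_pow, (hf i (Finset.mem_range.1 hi)).2, ← pow_mul, mul_comm])
      (fun _ => h) fun _ => le_rfl
    rw [natDegree_prod _ _ hne, hmr] at this
    simp only [natDegree_pow, ← Finset.mul_sum] at this
    exact Nat.le_of_mul_le_mul_left this hh0
  have hcop : (Fintype.card F - 1).Coprime p := by
    refine Nat.Coprime.coprime_dvd_right (dvd_pow_self p he.ne') ?_
    rw [← hq]
    exact (Nat.coprime_self_sub_left hq1.le).2 (Nat.coprime_one_left _)
  have hexp : ∀ j, 0 < j → (f 0).coeff j ≠ 0 → j = (f 0).natDegree ∧ ∃ k, j = p ^ k := by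
    intro j hj0 hj
    have hjm := (le_natDegree_of_ne_zero hj).trans (hf 0 he).1
    refine eq_and_eq_pow_of_sum_mod_le hp.two_le hj0 (by omega) (fun i => (f i).natDegree) ?_ hdeg
    intro i hi
    rw [← hq]
    refine mod_le_natDegree_of_eval_eq_pow hcop (P := f 0) ?_ ?_ ?_ hj
    · have := (hf 0 he).1
      omega
    · have := (hf i hi).1
      omega
    · intro x
      rw [(hf i hi).2, hf0]
  have hnd : 0 < (f 0).natDegree := by
    by_contra hcon
    have hC := eq_C_of_natDegree_eq_zero (Nat.eq_zero_of_not_pos hcon)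
    refine zero_ne_one (σ.injective ?_)
    rw [← hf0, ← hf0, hC, eval_C, eval_C]
  have hlead : (f 0).coeff (f 0).natDegree ≠ 0 :=
    leadingCoeff_ne_zero.2 (ne_zero_of_natDegree_gt hnd)
  obtain ⟨k, hk⟩ := (hexp _ hnd hlead).2
  refine ⟨(f 0).coeff (f 0).natDegree, (f 0).coeff 0, k, fun v => ?_⟩
  have hf0eq : f 0 = C ((f 0).coeff (f 0).natDegree) * X ^ (f 0).natDegree +
      C ((f 0).coeff 0) := by
    ext j
    rw [coeff_add, coeff_C_mul_X_pow, coeff_C]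
    rcases Nat.eq_zero_or_pos j with rfl | hj0
    · simp [hnd.ne]
    · by_cases hj : (f 0).coeff j = 0
      · rw [if_neg fun hjd : j = (f 0).natDegree => hlead (hjd ▸ hj), if_neg hj0.ne', hj, add_zero]
      · rw [if_pos (hexp j hj0 hj).1, if_neg hj0.ne', add_zero, ← (hexp j hj0 hj).1]
  rw [← hf0, ← hk]
  conv_lhs => rw [hf0eq]
  simp

end FiniteField

lemma paleyGraph_adj_iff {F : Type*} [Field F] [Fintype F] (h4 : Fintype.card F % 4 = 1)
    (u v : F) : (paleyGraph F).Adj u v ↔ u - v ≠ 0 ∧ IsSquare (u - v) := by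
  have hneg : IsSquare (-1 : F) := FiniteField.isSquare_neg_one_iff.2 (by omega)
  have hsymm : IsSquare (v - u) → IsSquare (u - v) := fun h => by
    simpa using hneg.mul h
  rw [paleyGraph, SimpleGraph.fromRel_adj, sub_ne_zero]
  tauto

/-- For a prime power `q = p^e ≡ 1 (mod 4)`, a permutation `σ` of `F_q` is an automorphism
of the Paley graph `P(q)` iff `σ(v) = a·v^(p^i) + b` for some nonzero square `a`, some
`b ∈ F_q` and some `i`; that is, `Aut P(q) = AΔL₁(q)`. -/
theorem paleyGraph_aut {F : Type*} [Field F] [Fintype F] (p : ℕ) (hp : p.Prime)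
    (hchar : ringChar F = p) (h4 : Fintype.card F % 4 = 1)
    (σ : Equiv.Perm F) :
    (∀ u v : F, (paleyGraph F).Adj (σ u) (σ v) ↔ (paleyGraph F).Adj u v) ↔
      ∃ (a b : F) (i : ℕ), a ≠ 0 ∧ IsSquare a ∧ ∀ v : F, σ v = a * v ^ p ^ i + b := by
  have hF2 : ringChar F ≠ 2 := fun h2 => by
    have := FiniteField.even_card_of_char_two h2
    omega
  have : CharP F p := ringChar.of_eq hchar
  have : Fact p.Prime := ⟨hp⟩
  simp only [paleyGraph_adj_iff h4]
  constructor
  · intro hadj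
    obtain ⟨a, b, i, hab⟩ := exists_eq_mul_pow_add hp (hchar ▸ hF2) σ fun u v => by
      rcases eq_or_ne u v with rfl | huv
      · simp
      have huv' : u - v ≠ 0 := sub_ne_zero.2 huv
      have hσ' : σ u - σ v ≠ 0 := sub_ne_zero.2 (σ.injective.ne huv)
      have hiff := hadj u v
      simp only [hσ', huv', ne_eq, not_false_eq_true, true_and, FiniteField.isSquare_iff hF2 hσ',
        FiniteField.isSquare_iff hF2 huv'] at hiff
      rcases FiniteField.pow_dichotomy hF2 huv' with h1 | h1
      · rw [h1, hiff.2 h1]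
      · rcases FiniteField.pow_dichotomy hF2 hσ' with h2 | h2
        · rw [h2, hiff.1 h2]
        · rw [h1, h2]
    have ha : σ 1 - σ 0 = a := by
      rw [hab, hab, one_pow, zero_pow (pow_pos hp.pos i).ne']
      ring
    have hsq := (hadj 1 0).2 (by simp)
    rw [ha] at hsq
    exact ⟨a, b, i, hsq.1, hsq.2, hab⟩
  · rintro ⟨a, b, i, ha0, ha, hab⟩ u v
    have hdiff : σ u - σ v = a * (u - v) ^ p ^ i := by
      rw [hab, hab, sub_pow_char_pow]
      ring
    have hodd : Odd (p ^ i) := (hp.odd_of_ne_two (hchar ▸ hF2)).pow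
    obtain ⟨r, hr⟩ := hodd
    rw [hdiff, mul_ne_zero_iff, pow_ne_zero_iff (pow_pos hp.pos i).ne']
    refine ⟨fun ⟨⟨_, h0⟩, hsq⟩ => ⟨h0, ?_⟩, fun ⟨h0, hsq⟩ => ⟨⟨ha0, h0⟩, ha.mul (hsq.pow _)⟩⟩
    have hfac : u - v = a * (u - v) ^ p ^ i / (a * ((u - v) ^ r * (u - v) ^ r)) := by
      rw [hr]
      field_simp
      ring
    rw [hfac]
    exact hsq.div (ha.mul ⟨_, rfl⟩)
end

section
/- (Carlitz's theorem) Let q be a power of an odd prime p, and let f : F_q → F_q be any function with f(0) = 0 and f(1) = 1 such that χ(f(u) − f(v)) = χ(u − v) for all u, v ∈ F_q. Then there exists a natural number i such that f(v) = v^{p^i} for all v ∈ F_q. -/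
open MvPolynomial

/-- If all base `2 * h + 1` digits of `k` are at most `h`, then the binomial coefficient of
`(p ^ n - 1) / 2` over `k` is prime to `p = 2 * h + 1`. -/
theorem not_dvd_choose_of_digits_le_s15 {p h : ℕ} (hp : p.Prime) (hph : p = 2 * h + 1) :
    ∀ {n m : ℕ}, p ^ n = 2 * m + 1 → ∀ d : Fin n → ℕ, (∀ i, d i ≤ h) →
      ¬ p ∣ m.choose (∑ i, d i * p ^ (i : ℕ))
  | 0, m, _, d, _ => by simpa using hp.one_lt.ne'
  | n + 1, m, hm, d, hd => by
    have := Fact.mk hp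
    obtain ⟨m', hm'⟩ : ∃ m', p ^ n = 2 * m' + 1 :=
      (Odd.pow ⟨h, hph⟩ : Odd (p ^ n))
    have hmm : m = h + p * m' := by
      rw [pow_succ, hm'] at hm
      have : (2 * m' + 1) * p = 2 * (p * m') + p := by ring
      omega
    have hsum : ∑ i, d i * p ^ (i : ℕ) = d 0 + p * ∑ i : Fin n, d i.succ * p ^ (i : ℕ) := by
      rw [Fin.sum_univ_succ, Finset.mul_sum]
      simp only [Fin.val_zero, pow_zero, mul_one, Fin.val_succ, pow_succ]
      congr 1
      exact Finset.sum_congr rfl fun i _ => by ring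
    have hd0 := hd 0
    rw [hsum, hmm, (Choose.choose_modEq_choose_mod_mul_choose_div_nat (p := p)).dvd_iff dvd_rfl,
      Nat.add_mul_mod_self_left, Nat.add_mul_mod_self_left, Nat.add_mul_div_left _ _ hp.pos,
      Nat.add_mul_div_left _ _ hp.pos, Nat.mod_eq_of_lt (by omega : h < p),
      Nat.mod_eq_of_lt (by omega : d 0 < p), Nat.div_eq_of_lt (by omega : h < p),
      Nat.div_eq_of_lt (by omega : d 0 < p), zero_add, zero_add, hp.dvd_mul, not_or]
    refine ⟨fun hdvd => ?_, not_dvd_choose_of_digits_le_s15 hp hph hm' _ fun i => hd i.succ⟩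
    have := (hp.dvd_factorial).1 (hdvd.trans (Dvd.intro _ (by
      rw [← mul_assoc]; exact Nat.choose_mul_factorial_mul_factorial hd0)))
    omega

section

variable {F : Type*} [Field F] [Fintype F]

/-- Extraction of a coefficient of `(a - z) ^ m` by a power sum over the finite field. -/
theorem FiniteField.sum_pow_mul_sub_pow (a : F) {m k : ℕ} (hk : k ≤ m)
    (hm : m < Fintype.card F - 1) :
    ∑ z : F, z ^ (Fintype.card F - 1 - k) * (a - z) ^ m =
      (-1) ^ (k + 1) * (m.choose k : F) * a ^ (m - k) := by
  have hexp (z : F) : z ^ (Fintype.card F - 1 - k) * (a - z) ^ m =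
      ∑ j ∈ Finset.range (m + 1), (-1) ^ j * (m.choose j : F) * a ^ (m - j) *
        z ^ (Fintype.card F - 1 - k + j) := by
    rw [sub_eq_neg_add, add_pow, Finset.mul_sum]
    refine Finset.sum_congr rfl fun j _ => ?_
    rw [neg_pow, pow_add]
    ring
  simp_rw [hexp]
  rw [Finset.sum_comm]
  simp_rw [← Finset.mul_sum]
  rw [Finset.sum_eq_single_of_mem k (Finset.mem_range.2 (by omega))]
  · rw [Nat.sub_add_cancel (by omega)]
    classical
    have hz (z : F) : z ^ (Fintype.card F - 1) = 1 - if z = 0 then 1 else 0 := by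
      split_ifs with hz
      · rw [hz, zero_pow (by omega), sub_self]
      · rw [FiniteField.pow_card_sub_one_eq_one z hz, sub_zero]
    simp [hz, pow_succ]
  · intro j hj hjk
    have hj := Finset.mem_range.1 hj
    rcases hjk.lt_or_gt with hlt | hgt
    · rw [FiniteField.sum_pow_lt_card_sub_one _ _ (by omega), mul_zero]
    · have hz (z : F) : z ^ (Fintype.card F - 1 - k + j) = z ^ (j - k) := by
        rw [show Fintype.card F - 1 - k + j = Fintype.card F + (j - k - 1) by omega, pow_add,
          FiniteField.pow_card, ← pow_succ', show j - k - 1 + 1 = j - k by omega]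
      simp_rw [hz]
      rw [FiniteField.sum_pow_lt_card_sub_one _ _ (by omega), mul_zero]

/-- A polynomial of degree less than `p` in each of `n` variables that vanishes at all points
`(x, x ^ p, …, x ^ p ^ (n - 1))`, `x` in the field with `p ^ n` elements, is zero. -/
theorem MvPolynomial.eq_zero_of_eval_pow_eq_zero {p n : ℕ} (hcard : Fintype.card F = p ^ n)
    {P : MvPolynomial (Fin n) F} (hdeg : ∀ i, P.degreeOf i < p)
    (heval : ∀ x : F, eval (fun i : Fin n => x ^ p ^ (i : ℕ)) P = 0) : P = 0 := by
  have hlt : ∀ s ∈ P.support, ∀ i, s i < p := fun s hs i =>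
    (degreeOf_le_iff.1 le_rfl s hs).trans_lt (hdeg i)
  let e : (Fin n →₀ ℕ) → ℕ := fun s => ∑ i, s i * p ^ (i : ℕ)
  have he : ∀ s (hs : s ∈ P.support),
      e s = (finFunctionFinEquiv (fun i => (⟨s i, hlt s hs i⟩ : Fin p)) : ℕ) := fun s hs => by
    rw [finFunctionFinEquiv_apply]
  let Q : Polynomial F := ∑ s ∈ P.support, Polynomial.monomial (e s) (P.coeff s)
  have hQ : Q = 0 := by
    refine Polynomial.eq_zero_of_natDegree_lt_card_of_eval_eq_zero Q Function.injective_id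
      (fun x => ?_) ?_
    · rw [← heval x, eval_eq']
      simp only [Q, Polynomial.eval_finsetSum, Polynomial.eval_monomial, id]
      refine Finset.sum_congr rfl fun s _ => ?_
      simp only [e, ← Finset.prod_pow_eq_pow_sum, ← pow_mul, mul_comm]
    · refine lt_of_le_of_lt (Polynomial.natDegree_sum_le_of_forall_le (n := Fintype.card F - 1) _ _
        fun s hs => (Polynomial.natDegree_monomial_le _).trans ?_)
        (Nat.sub_lt Fintype.card_pos one_pos)
      have := (finFunctionFinEquiv (fun i => (⟨s i, hlt s hs i⟩ : Fin p))).2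
      rw [← he s hs] at this
      omega
  by_contra hP
  obtain ⟨s, hs⟩ := Finset.nonempty_of_ne_empty (mt support_eq_empty.1 hP)
  refine mem_support_iff.1 hs ?_
  have hc : Q.coeff (e s) = P.coeff s := by
    simp only [Q, Polynomial.finsetSum_coeff, Polynomial.coeff_monomial]
    rw [Finset.sum_eq_single_of_mem s hs, if_pos rfl]
    intro t ht hts
    refine if_neg fun h => hts ?_
    rw [he t ht, he s hs] at h
    have h' := finFunctionFinEquiv.injective (Fin.ext h)
    ext i
    exact congrArg Fin.val (congrFun h' i)
  rw [← hc, hQ, Polynomial.coeff_zero]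

/-- Two reduced representations of a function on a finite field agree. -/
theorem MvPolynomial.eq_of_eval_pow_eq {p n : ℕ} (hcard : Fintype.card F = p ^ n)
    {P Q : MvPolynomial (Fin n) F} (hP : ∀ i, P.degreeOf i < p) (hQ : ∀ i, Q.degreeOf i < p)
    (heval : ∀ x : F, eval (fun i : Fin n => x ^ p ^ (i : ℕ)) P =
      eval (fun i : Fin n => x ^ p ^ (i : ℕ)) Q) : P = Q :=
  sub_eq_zero.1 <| eq_zero_of_eval_pow_eq_zero hcard
    (fun i => (degreeOf_sub_le i P Q).trans_lt (max_lt (hP i) (hQ i)))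
    fun x => by rw [map_sub, heval, sub_self]

/-- If `f` preserves the `m`-th powers of differences, `m = (p ^ n - 1) / 2`, then every power
`f ^ k` whose exponent has all base `p` digits at most `h = (p - 1) / 2` is represented by a
polynomial of degree at most `h` in each of `x, x ^ p, …, x ^ p ^ (n - 1)`. -/
theorem exists_mvPolynomial_eval_eq_pow {p n h m : ℕ} [CharP F p] (hp : p.Prime)
    (hcard : Fintype.card F = p ^ n) (hph : p = 2 * h + 1) (hm : p ^ n = 2 * m + 1) {f : F → F}
    (hinj : Function.Injective f) (hf : ∀ u v, (f u - f v) ^ m = (u - v) ^ m)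
    (d : Fin n → ℕ) (hd : ∀ i, d i ≤ h) :
    ∃ R : MvPolynomial (Fin n) F, (∀ i, R.degreeOf i ≤ h) ∧
      ∀ x, eval (fun i : Fin n => x ^ p ^ (i : ℕ)) R = f x ^ ∑ i, d i * p ^ (i : ℕ) := by
  have := Fact.mk hp
  set k := ∑ i, d i * p ^ (i : ℕ)
  have hchoose : ¬ p ∣ m.choose k := not_dvd_choose_of_digits_le_s15 hp hph hm d hd
  have hkm : k ≤ m := by
    by_contra hlt
    exact hchoose (by simp [Nat.choose_eq_zero_of_lt (not_le.1 hlt)])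
  have hc0 : (-1) ^ (m - k + 1) * (m.choose k : F) ≠ 0 :=
    mul_ne_zero (pow_ne_zero _ (neg_ne_zero.2 one_ne_zero))
      (mt (CharP.cast_eq_zero_iff F p _).1 hchoose)
  have hcard1 := Fintype.one_lt_card (α := F)
  have hprod (u : F) : u ^ m = ∏ i : Fin n, (u ^ p ^ (i : ℕ)) ^ h := by
    simp_rw [← pow_mul]
    rw [Finset.prod_pow_eq_pow_sum, ← Finset.sum_mul, Fin.sum_univ_eq_sum_range (fun i => p ^ i)]
    congr 1
    have hgeom := geom_sum_mul_add (2 * h) n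
    rw [← hph, hm, ← mul_assoc, mul_right_comm] at hgeom
    omega
  refine ⟨C ((-1) ^ (m - k + 1) * (m.choose k : F))⁻¹ *
    ∑ y : F, C (f y ^ (Fintype.card F - 1 - (m - k))) *
      ∏ i : Fin n, (X i - C (y ^ p ^ (i : ℕ))) ^ h, fun i => ?_, fun x => ?_⟩
  · refine (degreeOf_C_mul_le _ _ _).trans ((degreeOf_sum_le _ _ _).trans
      (Finset.sup_le fun y _ => (degreeOf_C_mul_le _ _ _).trans ((degreeOf_prod_le _ _ _).trans ?_)))
    calc ∑ j : Fin n, degreeOf i ((X j - C (y ^ p ^ (j : ℕ))) ^ h : MvPolynomial (Fin n) F)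
        ≤ ∑ j : Fin n, if i = j then h else 0 := by
          refine Finset.sum_le_sum fun j _ => (degreeOf_pow_le _ _ _).trans ?_
          refine (Nat.mul_le_mul_left h (degreeOf_sub_le _ _ _)).trans ?_
          rw [degreeOf_C, degreeOf_X]
          split_ifs <;> simp
      _ = h := by simp
  · have hsum : ∑ y : F, f y ^ (Fintype.card F - 1 - (m - k)) * (x - y) ^ m =
        (-1) ^ (m - k + 1) * (m.choose k : F) * f x ^ k := by
      simp_rw [← hf x]
      rw [(Finite.injective_iff_bijective.1 hinj).sum_comp
        (fun z => z ^ (Fintype.card F - 1 - (m - k)) * (f x - z) ^ m),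
        FiniteField.sum_pow_mul_sub_pow _ (Nat.sub_le _ _) (by omega), Nat.choose_symm hkm,
        Nat.sub_sub_self hkm]
    have hev (y : F) : ∏ i : Fin n, (x ^ p ^ (i : ℕ) - y ^ p ^ (i : ℕ)) ^ h = (x - y) ^ m := by
      rw [hprod]
      simp_rw [sub_pow_char_pow]
    simp only [map_mul, map_sum, map_prod, map_pow, map_sub, eval_C, eval_X, hev]
    rw [hsum, inv_mul_cancel_left₀ hc0]

/-- The `p ^ j`-th power of a function represented by `P` is represented by the polynomial obtained
by applying Frobenius to the coefficients and shifting the variables cyclically. -/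
theorem MvPolynomial.eval_rename_map_iterateFrobenius {p n : ℕ} [NeZero n] [CharP F p]
    [Fact p.Prime] (hcard : Fintype.card F = p ^ n) (P : MvPolynomial (Fin n) F) (j : Fin n)
    (x : F) :
    eval (fun i : Fin n => x ^ p ^ (i : ℕ))
        (rename (· + j) (map (iterateFrobenius F p (j : ℕ)) P)) =
      eval (fun i : Fin n => x ^ p ^ (i : ℕ)) P ^ p ^ (j : ℕ) := by
  rw [← iterateFrobenius_def, eval_rename, eval_map, ← eval₂_id (p := P), eval₂_comp_left,
    RingHom.comp_id]
  congr 1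
  ext i
  simp only [Function.comp_apply, iterateFrobenius_def, Fin.val_add, ← pow_mul, ← pow_add]
  conv_rhs => rw [← Nat.div_add_mod (i + j : ℕ) n, pow_add, pow_mul p n, ← hcard, pow_mul,
    FiniteField.pow_card_pow]

end

theorem MvPolynomial.degreeOf_rename_map_iterateFrobenius {F : Type*} [Field F] {p n : ℕ}
    [NeZero n] [CharP F p] [Fact p.Prime] (P : MvPolynomial (Fin n) F) (j i : Fin n) :
    degreeOf (i + j) (rename (· + j) (map (iterateFrobenius F p (j : ℕ)) P)) = degreeOf i P := by
  rw [degreeOf_rename_of_injective (add_left_injective j), degreeOf_eq_sup, degreeOf_eq_sup,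
    support_map_of_injective _ (iterateFrobenius F p j).injective]

/-- A polynomial of degree at most one in a single variable `X a` is affine in `X a`. -/
theorem MvPolynomial.eval_eq_of_degreeOf_eq_zero_of_ne {σ R : Type*} [CommSemiring R]
    {P : MvPolynomial σ R} {a : σ} (ha : P.degreeOf a ≤ 1) (hne : ∀ b ≠ a, P.degreeOf b = 0)
    (g : σ → R) : eval g P = P.coeff 0 + P.coeff (Finsupp.single a 1) * g a := by
  have hsub : P = C (P.coeff 0) + C (P.coeff (Finsupp.single a 1)) * X a := by
    classical
    ext s
    by_cases hs : s ∈ P.support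
    · have h1 := degreeOf_le_iff.1 ha s hs
      have h2 : ∀ b ≠ a, s b = 0 := fun b hb =>
        Nat.le_zero.1 (degreeOf_le_iff.1 (hne b hb).le s hs)
      have : s = Finsupp.single a (s a) := by
        ext b
        by_cases hb : b = a
        · simp [hb]
        · simp [Ne.symm hb, h2 b hb]
      rw [this]
      interval_cases s a <;> simp [coeff_X, coeff_C, coeff_C_mul, eq_comm (a := (0 : σ →₀ ℕ))]
    · have hs' := notMem_support_iff.1 hs
      rw [coeff_add, coeff_C, coeff_C_mul, coeff_X, hs']
      split_ifs with h1 h2 h2 <;> simp_all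
  conv_lhs => rw [hsub]
  simp

/-- Carlitz's theorem: for a power `q` of an odd prime `p`, any function `f : F_q → F_q`
with `f(0) = 0`, `f(1) = 1` and `χ(f(u) − f(v)) = χ(u − v)` for all `u, v` is of the form
`f(v) = v^(p^i)` for some `i`. -/
theorem carlitz_theorem {F : Type*} [Field F] [Fintype F] [DecidableEq F]
    (p : ℕ) (hp : p.Prime) (hodd : p ≠ 2) (hchar : ringChar F = p)
    (f : F → F) (h0 : f 0 = 0) (h1 : f 1 = 1)
    (hf : ∀ u v : F, quadraticChar F (f u - f v) = quadraticChar F (u - v)) :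
    ∃ i : ℕ, ∀ v : F, f v = v ^ p ^ i := by
  have := Fact.mk hp
  have : CharP F p := hchar ▸ ringChar.charP F
  obtain ⟨⟨n, hn⟩, -, hcard⟩ := FiniteField.card F p
  have : NeZero n := ⟨hn.ne'⟩
  replace hcard : Fintype.card F = p ^ n := hcard
  obtain ⟨h, hph⟩ := hp.odd_of_ne_two hodd
  obtain ⟨m, hm⟩ : Odd (p ^ n) := (hp.odd_of_ne_two hodd).pow
  have hh : 1 ≤ h := by have := hp.two_le; omega
  have hpow (u v : F) : (f u - f v) ^ m = (u - v) ^ m := by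
    have hm' : Fintype.card F / 2 = m := by omega
    have hF : ringChar F ≠ 2 := hchar ▸ hodd
    rw [← hm', ← quadraticChar_eq_pow_of_char_ne_two' hF, hf,
      quadraticChar_eq_pow_of_char_ne_two' hF]
  have hinj : Function.Injective f := fun u v huv => by
    have := hf u v
    rw [huv, sub_self, quadraticChar_zero] at this
    exact sub_eq_zero.1 (quadraticChar_eq_zero_iff.1 this.symm)
  -- A reduced representation of an admissible power of `f` has degrees at most `h`.
  have hred (d : Fin n → ℕ) (hd : ∀ i, d i ≤ h) (Q : MvPolynomial (Fin n) F)
      (hQ : ∀ i, Q.degreeOf i < p)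
      (hev : ∀ x, eval (fun i : Fin n => x ^ p ^ (i : ℕ)) Q = f x ^ ∑ i, d i * p ^ (i : ℕ)) (i) :
      Q.degreeOf i ≤ h := by
    obtain ⟨R, hR, hRev⟩ := exists_mvPolynomial_eval_eq_pow hp hcard hph hm hinj hpow d hd
    rw [MvPolynomial.eq_of_eval_pow_eq hcard hQ (fun i => (hR i).trans_lt (by omega))
      fun x => (hev x).trans (hRev x).symm]
    exact hR i
  obtain ⟨P, hPh, hP⟩ := exists_mvPolynomial_eval_eq_pow hp hcard hph hm hinj hpow
    (Pi.single 0 1) fun i => by by_cases hi : i = 0 <;> simp [hi, hh]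
  have hsingle (c : ℕ) (j : Fin n) :
      ∑ i, (Pi.single j c : Fin n → ℕ) i * p ^ (i : ℕ) = c * p ^ (j : ℕ) := by
    rw [Fintype.sum_eq_single j fun i hi => by simp [hi], Pi.single_eq_same]
  simp only [hsingle, Fin.val_zero, pow_zero, mul_one, pow_one] at hP
  have hP0 : P ≠ 0 := by
    rintro rfl
    simpa [h1] using hP 1
  have hmul (c : ℕ) (hc : c < h) (i : Fin n) : (c + 1) * P.degreeOf i ≤ h := by
    induction c generalizing i with
    | zero => simpa using hPh i
    | succ c ih =>
      rw [← degreeOf_pow_eq i P _ hP0]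
      refine hred (Pi.single 0 (c + 1 + 1)) (fun i => ?_) _ (fun i => ?_) (fun x => ?_) i
      · by_cases hi : i = 0 <;> simp [hi]; omega
      · rw [degreeOf_pow_eq i P _ hP0, add_mul]
        have := ih (by omega) i
        have := hPh i
        omega
      · rw [map_pow, hP, hsingle]
        simp
  have hP1 (i : Fin n) : P.degreeOf i ≤ 1 := by
    have := hmul (h - 1) (by omega) i
    rw [Nat.sub_add_cancel hh] at this
    exact Nat.le_of_mul_le_mul_left (by omega) hh
  have hpair (a b : Fin n) (hab : a ≠ b) (ha : P.degreeOf a ≠ 0) : P.degreeOf b = 0 := by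
    by_contra hb
    set j := b - a with hj
    have hj0 : j ≠ 0 := sub_ne_zero.2 hab.symm
    set Pj := rename (· + j) (map (iterateFrobenius F p (j : ℕ)) P) with hPj
    have hdegj (i : Fin n) : Pj.degreeOf i = P.degreeOf (i - j) := by
      conv_lhs => rw [← sub_add_cancel i j]
      exact degreeOf_rename_map_iterateFrobenius P j (i - j)
    have hPj0 : Pj ≠ 0 := by
      intro h0
      have := hdegj b
      rw [h0, degreeOf_zero, hj, sub_sub_cancel] at this
      exact ha this.symm
    have hdeg (i : Fin n) : (P ^ h * Pj ^ h).degreeOf i =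
        h * P.degreeOf i + h * P.degreeOf (i - j) := by
      rw [degreeOf_mul_eq (pow_ne_zero _ hP0) (pow_ne_zero _ hPj0), degreeOf_pow_eq _ _ _ hP0,
        degreeOf_pow_eq _ _ _ hPj0, hdegj]
    have key := hred (Pi.single 0 h + Pi.single j h) (fun i => ?_) (P ^ h * Pj ^ h) (fun i => ?_)
      (fun x => ?_) b
    · rw [hdeg, hj, sub_sub_cancel] at key
      have := Nat.mul_le_mul_left h (Nat.one_le_iff_ne_zero.2 ha)
      have := Nat.mul_le_mul_left h (Nat.one_le_iff_ne_zero.2 hb)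
      omega
    · by_cases hi : i = 0
      · simp [hi, hj0.symm]
      · by_cases hij : i = j <;> simp [hi, hij, hj0]
    · rw [hdeg]
      have := Nat.mul_le_mul_left h (hP1 i)
      have := Nat.mul_le_mul_left h (hP1 (i - j))
      omega
    · simp only [Pi.add_apply, add_mul, Finset.sum_add_distrib, hsingle]
      rw [map_mul, map_pow, map_pow, hPj, eval_rename_map_iterateFrobenius hcard, hP, pow_add,
        ← pow_mul, mul_comm h (p ^ (j : ℕ))]
      simp
  obtain ⟨a, ha⟩ : ∃ a, ∀ b ≠ a, P.degreeOf b = 0 := by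
    by_cases hex : ∃ a, P.degreeOf a ≠ 0
    · obtain ⟨a, ha⟩ := hex
      exact ⟨a, fun b hb => hpair a b hb.symm ha⟩
    · push Not at hex
      exact ⟨0, fun b _ => hex b⟩
  have hform (x : F) := (hP x).symm.trans (eval_eq_of_degreeOf_eq_zero_of_ne (hP1 a) ha _)
  have hα := hform 0
  have hβ := hform 1
  rw [h0, zero_pow (pow_ne_zero _ hp.ne_zero), mul_zero, add_zero] at hα
  rw [h1, one_pow, mul_one, ← hα, zero_add] at hβ
  exact ⟨a, fun v => by rw [hform v, ← hα, ← hβ, zero_add, one_mul]⟩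
end
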